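/- arXiv:0907.0343 — 4 statements merged into one kernel-verified Lean document; each statement's English description precedes it below -/
import Mathlib

section
/- Let K be a Hilbertian field and let f(X,Y) ∈ K[X,Y] be irreducible and separable in Y. Then the Hilbert set H(f) = {a ∈ K : f(a,Y) is irreducible in K[Y]} has cardinality equal to |K|. -/
open Polynomial

/-- The Hilbert set of a polynomial `f(X,Y) ∈ K[X][Y]` (with `Y` the outer variable):
the set of `a ∈ K` such that the specialized polynomial `f(a,Y) ∈ K[Y]` is irreducible. -/
def HilbertSet {K : Type*} [Field K] (f : Polynomial (Polynomial K)) : Set K :=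
  {a : K | Irreducible (f.map (Polynomial.evalRingHom a))}

/-- A field `K` is Hilbertian if for every irreducible `f(X,Y) ∈ K[X,Y]` which is
separable in `Y` (i.e. `∂f/∂Y ≠ 0`), there are infinitely many `a ∈ K` with `f(a,Y)`
irreducible in `K[Y]`. -/
def IsHilbertian (K : Type*) [Field K] : Prop :=
  ∀ f : Polynomial (Polynomial K), Irreducible f → f.derivative ≠ 0 →
    (HilbertSet f).Infinite

namespace HilbertSet

universe u v

/-- Every point `a` of the affine line over `K` lifts to a point, valued in some extension field
of `K`, of the normalization of the affine line in `L`. -/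
lemma exists_specialization {K : Type*} {L : Type u} [Field K] [Field L] [Algebra K[X] L]
    [Module.IsTorsionFree K[X] L] (a : K) :
    ∃ (M : Type u) (_ : Field M) (_ : Algebra K M) (ψ : integralClosure K[X] L →+* M),
      ∀ p : K[X], ψ (algebraMap K[X] _ p) = algebraMap K M (p.eval a) := by
  have hP : (RingHom.ker (evalRingHom a)).IsMaximal :=
    RingHom.ker_isMaximal_of_surjective _ fun b => ⟨C b, by simp⟩
  have hinj : Function.Injective (algebraMap K[X] (integralClosure K[X] L)) :=
    FaithfulSMul.algebraMap_injective _ _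
  obtain ⟨Q, hQ, hQP⟩ := Ideal.exists_ideal_over_maximal_of_isIntegral
    (S := integralClosure K[X] L) (RingHom.ker (evalRingHom a))
    (by rw [(RingHom.injective_iff_ker_eq_bot _).1 hinj]; exact bot_le)
  refine ⟨integralClosure K[X] L ⧸ Q, Ideal.Quotient.field Q,
    (((Ideal.Quotient.mk Q).comp (algebraMap K[X] _)).comp C).toAlgebra,
    Ideal.Quotient.mk Q, fun p => ?_⟩
  rw [RingHom.algebraMap_toAlgebra]
  simp only [RingHom.comp_apply]
  rw [Ideal.Quotient.eq, ← map_sub, ← Ideal.mem_comap, hQP, RingHom.mem_ker]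
  simp

/-- Linear independence of powers of an integral element specializes at almost every point at which
the minimal polynomial of an integral primitive element stays irreducible. -/
lemma linearIndependent_specialization {K F L : Type*} [Field K] [Field F] [Field L]
    [Algebra K[X] F] [IsFractionRing K[X] F] [Algebra K[X] L] [Algebra F L]
    [IsScalarTower K[X] F L] [FiniteDimensional F L]
    (z y : integralClosure K[X] L) (hz : IntermediateField.adjoin F {(z : L)} = ⊤) {m : ℕ}
    (hy : LinearIndependent F fun i : Fin m => (y : L) ^ (i : ℕ)) :
    ∃ d : K[X], d ≠ 0 ∧ ∀ a : K, d.eval a ≠ 0 → a ∈ HilbertSet (minpoly K[X] (z : L)) →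
      ∀ (M : Type v) [Field M] [Algebra K M] (ψ : integralClosure K[X] L →+* M),
        (∀ p : K[X], ψ (algebraMap K[X] _ p) = algebraMap K M (p.eval a)) →
        LinearIndependent K fun i : Fin m => ψ y ^ (i : ℕ) := by
  classical
  have hzint : IsIntegral K[X] (z : L) := z.2
  let b := Module.Basis.sumExtend hy
  let n := (minpoly K[X] (z : L)).natDegree
  have hmap := minpoly.isIntegrallyClosed_eq_field_fractions' F hzint
  have hmonic := minpoly.monic hzint
  have hn : n = Module.finrank F L := by
    rw [← (Field.primitive_element_iff_minpoly_natDegree_eq F (z : L)).1 hz, hmap,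
      hmonic.natDegree_map]
  let _ : Fintype (Fin m ⊕ Module.Basis.sumExtendIndex hy) := FiniteDimensional.fintypeBasisIndex b
  have := IsLocalization.isAlgebraic F (nonZeroDivisors K[X])
  have := Algebra.IsAlgebraic.trans K[X] F L
  obtain ⟨D, hD0, hD⟩ := Algebra.IsAlgebraic.exists_integral_multiples K[X] (Finset.univ.image b)
  let v : Fin m ⊕ Module.Basis.sumExtendIndex hy → integralClosure K[X] L :=
    fun j => ⟨D • b j, hD _ (by simp)⟩
  have hDF : algebraMap K[X] F D ≠ 0 := by simpa using hD0
  obtain ⟨⟨e, he⟩, hC⟩ := IsLocalization.exist_integer_multiples_of_finite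
    (nonZeroDivisors K[X]) (fun kj : Fin n × (Fin m ⊕ Module.Basis.sumExtendIndex hy) =>
      b.repr ((z : L) ^ (kj.1 : ℕ)) kj.2 / algebraMap K[X] F D)
  choose c hc using hC
  have hrel (k : Fin n) : e • z ^ (k : ℕ) = ∑ j, c (k, j) • v j := by
    apply Subtype.ext
    have h1 : (z : L) ^ (k : ℕ) = ∑ j, b.repr ((z : L) ^ (k : ℕ)) j • b j := (b.sum_repr _).symm
    simp only [SetLike.val_smul, SubmonoidClass.coe_pow, AddSubmonoidClass.coe_finsetSum, v]
    rw [h1, Finset.smul_sum]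
    refine Finset.sum_congr rfl fun j _ => ?_
    have h2 := hc (k, j)
    simp only [Algebra.smul_def] at h2
    rw [← IsScalarTower.algebraMap_smul F (c (k, j)), h2, ← IsScalarTower.algebraMap_smul F D,
      ← IsScalarTower.algebraMap_smul F e, smul_smul, smul_smul]
    congr 1
    field_simp
  refine ⟨e, nonZeroDivisors.ne_zero he, fun a hea ha M _ _ ψ hψ => ?_⟩
  have hsmul (p : K[X]) (x : integralClosure K[X] L) : ψ (p • x) = p.eval a • ψ x := by
    rw [Algebra.smul_def, map_mul, hψ, Algebra.smul_def]
  have hzpow : LinearIndependent K fun k : Fin n => ψ z ^ (k : ℕ) := by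
    have hroot : aeval (ψ z) ((minpoly K[X] (z : L)).map (evalRingHom a)) = 0 := by
      have h0 : eval₂ (algebraMap K[X] (integralClosure K[X] L)) z (minpoly K[X] (z : L)) = 0 := by
        apply Subtype.ext
        have h := hom_eval₂ (minpoly K[X] (z : L)) (algebraMap K[X] (integralClosure K[X] L))
          (integralClosure K[X] L).val.toRingHom z
        exact h.trans (minpoly.aeval K[X] (z : L))
      have h1 := congrArg ψ h0
      rw [hom_eval₂, map_zero] at h1
      rw [aeval_def, eval₂_map, ← h1]
      congr 1
      exact RingHom.ext fun p => (hψ p).symm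
    have hmin := minpoly.eq_of_irreducible_of_monic ha hroot (hmonic.map _)
    have hdeg : (minpoly K (ψ z)).natDegree = n := by
      rw [← hmin, hmonic.natDegree_map]
    have := linearIndependent_pow (K := K) (ψ z)
    rw [hdeg] at this
    exact this
  have hspan : Submodule.span K (Set.range fun k : Fin n => ψ z ^ (k : ℕ)) ≤
      Submodule.span K (Set.range (ψ ∘ v)) := by
    rw [Submodule.span_le]
    rintro _ ⟨k, rfl⟩
    have h1 := congrArg ψ (hrel k)
    simp only [hsmul, map_sum, map_pow] at h1
    have h2 : ψ z ^ (k : ℕ) = (e.eval a)⁻¹ • ∑ j, (c (k, j)).eval a • ψ (v j) := by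
      rw [← h1, inv_smul_smul₀ hea]
    simp only [h2, SetLike.mem_coe]
    exact Submodule.smul_mem _ _ (Submodule.sum_mem _ fun j _ =>
      Submodule.smul_mem _ _ (Submodule.subset_span ⟨j, rfl⟩))
  have hv : LinearIndependent K (ψ ∘ v) := by
    rw [linearIndependent_iff_card_le_finrank_span]
    have : FiniteDimensional K (Submodule.span K (Set.range (ψ ∘ v))) :=
      FiniteDimensional.span_of_finite K (Set.finite_range _)
    have h1 := Submodule.finrank_mono hspan
    rw [finrank_span_eq_card hzpow, Fintype.card_fin, hn, Module.finrank_eq_card_basis b] at h1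
    exact h1
  have hvl := hv.comp Sum.inl Sum.inl_injective
  refine LinearIndependent.of_comp (LinearMap.lsmul K M (D.eval a)) ?_
  convert hvl using 1
  ext i
  have : v (Sum.inl i) = D • y ^ (i : ℕ) := by
    apply Subtype.ext
    simp only [v, b, Module.Basis.sumExtend, Module.Basis.coe_reindex, Module.Basis.coe_extend]
    rfl
  simp [this, hsmul]

/-- A polynomial with a root whose powers below its degree are independent is irreducible. -/
lemma irreducible_of_linearIndependent_pow {K M : Type*} [Field K] [Field M] [Algebra K M]
    {p : K[X]} (hp : p ≠ 0) {x : M} (hx : aeval x p = 0)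
    (hli : LinearIndependent K fun i : Fin p.natDegree => x ^ (i : ℕ)) : Irreducible p := by
  have hint : IsIntegral K x := IsAlgebraic.isIntegral ⟨p, hp, hx⟩
  have hle : p.natDegree ≤ (minpoly K x).natDegree := by
    by_contra! hlt
    have h0 := minpoly.aeval K x
    rw [aeval_eq_sum_range' hlt, Finset.sum_range] at h0
    have h1 := Fintype.linearIndependent_iff.1 hli _ h0 ⟨_, hlt⟩
    rw [coeff_natDegree, (minpoly.monic hint).leadingCoeff] at h1
    exact one_ne_zero h1
  have hassoc : Associated (minpoly K x) p :=
    associated_of_dvd_of_natDegree_le (minpoly.dvd K x hx) hp hle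
  exact hassoc.irreducible (minpoly.irreducible hint)

lemma linearIndependent_smul_pow {K M : Type*} [Field K] [Field M] [Algebra K M] {m : ℕ} {x : M}
    (hli : LinearIndependent K fun i : Fin m => x ^ (i : ℕ)) {c : K} (hc : c ≠ 0) :
    LinearIndependent K fun i : Fin m => (c • x) ^ (i : ℕ) := by
  convert hli.units_smul (fun i => Units.mk0 c hc ^ (i : ℕ)) using 1
  ext i
  simp [_root_.smul_pow, Units.smul_def]

/-- The Hilbert set of the minimal polynomial of an integral primitive element of `L` is, up to
finitely many points, contained in that of every irreducible polynomial with a root in `L`. -/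
lemma exists_forall_mem_of_aeval_eq_zero {K F L : Type*} [Field K] [Field F] [Field L]
    [Algebra K[X] F] [IsFractionRing K[X] F] [Algebra K[X] L] [Algebra F L]
    [IsScalarTower K[X] F L] [FiniteDimensional F L]
    (z : integralClosure K[X] L) (hz : IntermediateField.adjoin F {(z : L)} = ⊤)
    {f : K[X][X]} (hf : Irreducible f) (hdeg : f.natDegree ≠ 0) {y : L} (hy : aeval y f = 0) :
    ∃ d : K[X], d ≠ 0 ∧ ∀ a : K, d.eval a ≠ 0 → a ∈ HilbertSet (minpoly K[X] (z : L)) →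
      a ∈ HilbertSet f := by
  have hinj : Function.Injective (algebraMap K[X] F) := IsFractionRing.injective K[X] F
  have hinjL : Function.Injective (algebraMap K[X] L) := by
    rw [IsScalarTower.algebraMap_eq K[X] F L]
    exact (algebraMap F L).injective.comp hinj
  have : FaithfulSMul K[X] L := (faithfulSMul_iff_algebraMap_injective _ _).2 hinjL
  have hlc : f.leadingCoeff ≠ 0 := leadingCoeff_ne_zero.2 hf.ne_zero
  have hfF : Irreducible (f.map (algebraMap K[X] F)) :=
    (hf.isPrimitive hdeg).irreducible_iff_irreducible_map_fraction_map.1 hf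
  have hmin : (minpoly F y).natDegree = f.natDegree := by
    rw [← minpoly.eq_of_irreducible hfF (by rwa [aeval_map_algebraMap]),
      natDegree_mul_C (inv_ne_zero (leadingCoeff_ne_zero.2 hfF.ne_zero)), natDegree_map_eq_of_injective hinj]
  have hli := linearIndependent_pow (K := F) y
  rw [hmin] at hli
  let y' : integralClosure K[X] L := ⟨f.leadingCoeff • y, isIntegral_leadingCoeff_smul f y hy⟩
  have hli' : LinearIndependent F fun i : Fin f.natDegree => (y' : L) ^ (i : ℕ) := by
    simpa [y'] using linearIndependent_smul_pow hli (c := algebraMap K[X] F f.leadingCoeff)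
      (by simpa using hf.ne_zero)
  obtain ⟨d, hd0, hd⟩ := linearIndependent_specialization z y' hz hli'
  refine ⟨d * f.leadingCoeff, mul_ne_zero hd0 hlc, fun a hda ha => ?_⟩
  rw [eval_mul] at hda
  have hla : f.leadingCoeff.eval a ≠ 0 := right_ne_zero_of_mul hda
  obtain ⟨M, _, _, ψ, hψ⟩ := exists_specialization (L := L) a
  have hli'' := linearIndependent_smul_pow (hd a (left_ne_zero_of_mul hda) ha M ψ hψ)
    (inv_ne_zero hla)
  set η := (f.leadingCoeff.eval a)⁻¹ • ψ y' with hη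
  let φ := ψ.comp (algebraMap K[X] (integralClosure K[X] L))
  have hφ : φ = (algebraMap K M).comp (evalRingHom a) := RingHom.ext hψ
  have hφlc : φ f.leadingCoeff ≠ 0 := by simpa [hφ] using hla
  have hψy : ψ y' = φ f.leadingCoeff * η := by
    simp only [hφ, hη, RingHom.comp_apply, coe_evalRingHom, ← Algebra.smul_def]
    rw [smul_inv_smul₀ hla]
  have hnorm : eval₂ (algebraMap K[X] (integralClosure K[X] L)) y' f.integralNormalization = 0 := by
    apply Subtype.ext
    refine (hom_eval₂ f.integralNormalization (algebraMap K[X] (integralClosure K[X] L))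
      (integralClosure K[X] L).val.toRingHom y').trans ?_
    have h := integralNormalization_aeval_eq_zero hy fun x hx => hinjL (by simpa using hx)
    rwa [← Algebra.smul_def] at h
  have hroot : aeval η (f.map (evalRingHom a)) = 0 := by
    have h := congrArg ψ hnorm
    rw [hom_eval₂, map_zero, hψy] at h
    erw [integralNormalization_eval₂_leadingCoeff_mul (Nat.one_le_iff_ne_zero.2 hdeg) φ] at h
    rw [aeval_def, eval₂_map, ← hφ]
    exact (mul_eq_zero.1 h).resolve_left (pow_ne_zero _ hφlc)
  have hnd : (f.map (evalRingHom a)).natDegree = f.natDegree :=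
    natDegree_map_of_leadingCoeff_ne_zero _ hla
  refine irreducible_of_linearIndependent_pow ?_ hroot (by rwa [hnd])
  rintro h0
  rw [h0, natDegree_zero] at hnd
  exact hdeg hnd.symm

lemma isSeparable_of_aeval_eq_zero {K F E : Type*} [Field K] [Field F] [Field E]
    [Algebra K[X] F] [IsFractionRing K[X] F] [Algebra K[X] E] [Algebra F E]
    [IsScalarTower K[X] F E] {f : K[X][X]} (hf : Irreducible f) (hsep : derivative f ≠ 0)
    {y : E} (hy : aeval y f = 0) : IsSeparable F y := by
  have hinj : Function.Injective (algebraMap K[X] F) := IsFractionRing.injective K[X] F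
  have hdeg : f.natDegree ≠ 0 := fun h => hsep (derivative_of_natDegree_zero h)
  have hfF : Irreducible (f.map (algebraMap K[X] F)) :=
    (hf.isPrimitive hdeg).irreducible_iff_irreducible_map_fraction_map.1 hf
  have hfsep : (f.map (algebraMap K[X] F)).Separable := by
    rw [separable_iff_derivative_ne_zero hfF, derivative_map]
    exact (Polynomial.map_ne_zero_iff hinj).2 hsep
  exact hfsep.of_dvd (minpoly.dvd F y (by rwa [aeval_map_algebraMap]))

/-- Over a Hilbertian field, any two separable Hilbert sets meet. -/
lemma inter_nonempty {K : Type*} [Field K] (hK : IsHilbertian K) {f g : K[X][X]}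
    (hf : Irreducible f) (hfsep : derivative f ≠ 0) (hg : Irreducible g)
    (hgsep : derivative g ≠ 0) : (HilbertSet f ∩ HilbertSet g).Nonempty := by
  classical
  let F := FractionRing K[X]
  let E := AlgebraicClosure F
  have hinj : Function.Injective (algebraMap K[X] E) := by
    rw [IsScalarTower.algebraMap_eq K[X] F E]
    exact (algebraMap F E).injective.comp (IsFractionRing.injective K[X] F)
  have hfdeg : f.natDegree ≠ 0 := fun h => hfsep (derivative_of_natDegree_zero h)
  have hgdeg : g.natDegree ≠ 0 := fun h => hgsep (derivative_of_natDegree_zero h)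
  have hroot {p : K[X][X]} (hp : p.natDegree ≠ 0) : ∃ y : E, aeval y p = 0 :=
    IsAlgClosed.exists_eval₂_eq_zero_of_injective _ hinj p
      fun h => hp (natDegree_eq_of_degree_eq_some h)
  obtain ⟨y₁, hy₁⟩ := hroot hfdeg
  obtain ⟨y₂, hy₂⟩ := hroot hgdeg
  have hsep : ∀ x ∈ ({y₁, y₂} : Set E), IsSeparable F x := by
    rintro x (rfl | rfl)
    exacts [isSeparable_of_aeval_eq_zero hf hfsep hy₁, isSeparable_of_aeval_eq_zero hg hgsep hy₂]
  let L := IntermediateField.adjoin F ({y₁, y₂} : Set E)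
  have : FiniteDimensional F L :=
    IntermediateField.finiteDimensional_adjoin fun x hx => (hsep x hx).isIntegral
  have : Algebra.IsSeparable F L :=
    (IntermediateField.isSeparable_adjoin_iff_isSeparable F E).2 hsep
  have := IsLocalization.isAlgebraic F (nonZeroDivisors K[X])
  have := Algebra.IsAlgebraic.trans K[X] F L
  obtain ⟨z₀, hz₀⟩ := Field.exists_primitive_element F L
  obtain ⟨D, hD0, hD⟩ := (Algebra.IsAlgebraic.isAlgebraic (R := K[X]) z₀).exists_integral_multiple
  let z : integralClosure K[X] L := ⟨D • z₀, hD⟩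
  have hDF : algebraMap K[X] F D ≠ 0 := by simpa using hD0
  have hz : IntermediateField.adjoin F {(z : L)} = ⊤ := by
    rw [eq_top_iff, ← hz₀, IntermediateField.adjoin_simple_le_iff]
    have h1 : z₀ = (algebraMap K[X] F D)⁻¹ • (z : L) := by
      simp only [z]
      rw [← IsScalarTower.algebraMap_smul F D, inv_smul_smul₀ hDF]
    rw [h1]
    exact IntermediateField.smul_mem _ (IntermediateField.mem_adjoin_simple_self F _)
  have hmap : minpoly F (z : L) = (minpoly K[X] (z : L)).map (algebraMap K[X] F) :=
    minpoly.isIntegrallyClosed_eq_field_fractions' F hD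
  have hirr : Irreducible (minpoly K[X] (z : L)) := minpoly.irreducible hD
  have hder : derivative (minpoly K[X] (z : L)) ≠ 0 := by
    intro h0
    have h1 := Algebra.IsSeparable.isSeparable F (z : L)
    rw [IsSeparable, separable_iff_derivative_ne_zero
      (minpoly.irreducible (Algebra.IsIntegral.isIntegral _)), hmap, derivative_map, h0] at h1
    exact h1 (Polynomial.map_zero _)
  have hmem {p : K[X][X]} {y : E} (hy : aeval y p = 0) (hyL : y ∈ L) :
      aeval (⟨y, hyL⟩ : L) p = 0 := by
    apply Subtype.ext
    exact (hom_eval₂ p (algebraMap K[X] L) L.val.toRingHom ⟨y, hyL⟩).trans hy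
  obtain ⟨d₁, hd₁, h₁⟩ := exists_forall_mem_of_aeval_eq_zero z hz hf hfdeg
    (hmem hy₁ (IntermediateField.subset_adjoin F _ (by simp)))
  obtain ⟨d₂, hd₂, h₂⟩ := exists_forall_mem_of_aeval_eq_zero z hz hg hgdeg
    (hmem hy₂ (IntermediateField.subset_adjoin F _ (by simp)))
  obtain ⟨a, ha, had⟩ := (hK _ hirr hder).exists_notMem_finset (d₁ * d₂).roots.toFinset
  have had' : (d₁ * d₂).eval a ≠ 0 := by
    simpa [hd₁, hd₂] using had
  rw [eval_mul] at had'
  exact ⟨a, h₁ a (left_ne_zero_of_mul had') ha, h₂ a (right_ne_zero_of_mul had') ha⟩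

/-- Over a Hilbertian field, every element is a difference of two points of any given separable
Hilbert set. -/
lemma exists_sub_eq {K : Type*} [Field K] (hK : IsHilbertian K) {f : K[X][X]}
    (hf : Irreducible f) (hsep : derivative f ≠ 0) (c : K) :
    ∃ a ∈ HilbertSet f, ∃ b ∈ HilbertSet f, a - b = c := by
  let σ : K[X] ≃+* K[X] := (algEquivAevalXAddC c).toRingEquiv
  have hirr : Irreducible (f.map (σ : K[X] →+* K[X])) :=
    (MulEquiv.irreducible_iff (mapEquiv σ)).2 hf
  have hder : derivative (f.map (σ : K[X] →+* K[X])) ≠ 0 := by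
    rw [derivative_map]
    exact (Polynomial.map_ne_zero_iff σ.injective).2 hsep
  obtain ⟨b, hb, hb'⟩ := inter_nonempty hK hf hsep hirr hder
  refine ⟨b + c, ?_, b, hb, by ring⟩
  have h : (evalRingHom b).comp (σ : K[X] →+* K[X]) = evalRingHom (b + c) := by
    ext <;> simp [σ]
  rwa [HilbertSet, Set.mem_ofPred_eq, map_map, h] at hb'

end HilbertSet

/-- If `K` is Hilbertian and `f(X,Y) ∈ K[X,Y]` is irreducible and
separable in `Y`, then the Hilbert set `H(f)` has cardinality `|K|`. -/
theorem hilbertSet_cardinality {K : Type*} [Field K] (hK : IsHilbertian K)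
    (f : Polynomial (Polynomial K)) (hirr : Irreducible f) (hsep : f.derivative ≠ 0) :
    Cardinal.mk (HilbertSet f) = Cardinal.mk K := by
  refine le_antisymm (Cardinal.mk_set_le _) ?_
  have : Infinite (HilbertSet f) := (hK f hirr hsep).to_subtype
  have hsurj : Function.Surjective
      fun p : HilbertSet f × HilbertSet f => (p.1 : K) - (p.2 : K) := fun c => by
    obtain ⟨a, ha, b, hb, h⟩ := HilbertSet.exists_sub_eq hK hirr hsep c
    exact ⟨(⟨a, ha⟩, ⟨b, hb⟩), h⟩
  calc Cardinal.mk K ≤ Cardinal.mk (HilbertSet f × HilbertSet f) :=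
        Cardinal.mk_le_of_surjective hsurj
    _ = Cardinal.mk (HilbertSet f) := by
        rw [Cardinal.mk_prod, Cardinal.lift_id, Cardinal.mul_eq_self (Cardinal.aleph0_le_mk _)]
end

section
/- Let F/K(x) be finite Galois with L = F ∩ K_s, and let N/K be a Galois extension containing L. Then the map σ ↦ (σ|_F, σ|_N) gives a natural isomorphism Gal(FN/K(x)) ≅ Gal(F/K(x)) ×_{Gal(L/K)} Gal(N/K), where the fiber product is taken over the restriction maps. -/
noncomputable section

/-- A fixed algebraic closure of the rational function field `K(x)`. -/
abbrev Omega (K : Type) [Field K] := AlgebraicClosure (RatFunc K)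

instance (K : Type) [Field K] : Algebra K (Omega K) :=
  ((algebraMap (RatFunc K) (Omega K)).comp (algebraMap K (RatFunc K))).toAlgebra

section
variable {K k N E : Type*} [Field K] [Field k] [Field N] [Field E] [Algebra K k] [Algebra K N]
  [Algebra k E] [Algebra K E] [Algebra N E] [IsScalarTower K k E] [IsScalarTower K N E]

variable (K k N E) in
/-- Restriction of automorphisms of `E` over `k` to a normal extension `N` of a subfield `K` of
`k`. -/
def restrictNormalOverHom [Normal K N] : (E ≃ₐ[k] E) →* (N ≃ₐ[K] N) :=
  (AlgEquiv.restrictNormalHom N).comp (AlgEquiv.restrictScalarsHom K)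

theorem algebraMap_restrictNormalOverHom [Normal K N] (σ : E ≃ₐ[k] E) (a : N) :
    algebraMap N E (restrictNormalOverHom K k N E σ a) = σ (algebraMap N E a) :=
  AlgEquiv.restrictNormal_commutes (σ.restrictScalars K) N a

theorem continuous_restrictNormalOverHom [Normal K N] [Algebra.IsAlgebraic k E] :
    Continuous (restrictNormalOverHom K k N E) := by
  apply continuous_of_continuousAt_one _ (continuousAt_def.mpr _)
  intro U hU
  rw [map_one, krullTopology_mem_nhds_one_iff] at hU
  obtain ⟨M, _, hM⟩ := hU
  obtain ⟨s, rfl⟩ :=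
    IntermediateField.essFiniteType_iff.1 (inferInstance : Algebra.EssFiniteType K M)
  classical
  rw [krullTopology_mem_nhds_one_iff]
  refine ⟨IntermediateField.adjoin k (s.image (algebraMap N E) : Finset E),
    IntermediateField.finiteDimensional_adjoin fun x _ ↦ Algebra.IsIntegral.isIntegral x, ?_⟩
  intro σ hσ
  apply hM
  rw [SetLike.mem_coe, IntermediateField.mem_fixingSubgroup_iff] at hσ
  rw [SetLike.mem_coe, ← Subgroup.zpowers_le, ← IntermediateField.le_iff_le,
    IntermediateField.adjoin_le_iff]
  intro a ha
  have h : restrictNormalOverHom K k N E σ a = a := by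
    apply (algebraMap N E).injective
    rw [algebraMap_restrictNormalOverHom]
    exact hσ _ (IntermediateField.subset_adjoin _ _ (by
      exact_mod_cast Finset.mem_image_of_mem (algebraMap N E) ha))
  rw [SetLike.mem_coe, IntermediateField.mem_fixedField_iff]
  intro f hf
  exact (Subgroup.zpowers_le (H := MulAction.stabilizer (N ≃ₐ[K] N) a)).2 h hf

theorem exists_mem_fixingSubgroup_restrictNormalOverHom_eq [IsGalois K N] [IsGalois k E]
    (F : IntermediateField k E) (g : N ≃ₐ[K] N)
    (hg : ∀ a : N, algebraMap N E a ∈ F → g a = a) :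
    ∃ σ ∈ F.fixingSubgroup, restrictNormalOverHom K k N E σ = g := by
  have := krullTopology_t2 (K := K) (L := N)
  let H : ClosedSubgroup (N ≃ₐ[K] N) :=
    { toSubgroup := F.fixingSubgroup.map (restrictNormalOverHom K k N E)
      isClosed' := by
        exact ((InfiniteGalois.fixingSubgroup_isClosed F).isCompact.image
          continuous_restrictNormalOverHom).isClosed }
  change g ∈ H.1
  rw [← InfiniteGalois.fixingSubgroup_fixedField H, IntermediateField.mem_fixingSubgroup_iff]
  intro a ha
  apply hg
  rw [← InfiniteGalois.fixedField_fixingSubgroup F, IntermediateField.mem_fixedField_iff]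
  intro σ hσ
  rw [← algebraMap_restrictNormalOverHom (K := K),
    (IntermediateField.mem_fixedField_iff _ _).1 ha _ (Subgroup.mem_map_of_mem _ hσ)]

end

section
variable {K k Ω : Type*} [Field K] [Field k] [Field Ω] [Algebra K k] [Algebra k Ω] [Algebra K Ω]
  [IsScalarTower K k Ω]

theorem IntermediateField.normal_adjoin_of_normal [Normal k Ω] (N : IntermediateField K Ω)
    [Normal K N] : Normal k (adjoin k (N : Set Ω)) := by
  rw [normal_iff_forall_map_le]
  intro σ
  rw [adjoin_map, adjoin_le_iff]
  rintro _ ⟨a, ha, rfl⟩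
  apply subset_adjoin
  have h := (σ.restrictScalars K).restrictNormal_commutes N ⟨a, ha⟩
  change _ = σ a at h
  rw [← h]
  exact ((σ.restrictScalars K).restrictNormal N ⟨a, ha⟩).2

theorem IntermediateField.isGalois_adjoin_of_isGalois [Normal k Ω] (N : IntermediateField K Ω)
    [IsGalois K N] : IsGalois k (adjoin k (N : Set Ω)) where
  to_normal := N.normal_adjoin_of_normal
  to_isSeparable := by
    rw [isSeparable_adjoin_iff_isSeparable]
    intro a ha
    have h : IsSeparable K (⟨a, ha⟩ : N) := Algebra.IsSeparable.isSeparable K _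
    exact (IsSeparable.map N.val Subtype.val_injective h).tower_top k

theorem IntermediateField.exists_injective_restrict_prod
    (F E : IntermediateField k Ω) [IsGalois k F] [IsGalois k E] (L N : IntermediateField K Ω)
    [IsGalois K N] (hL : ∀ a : Ω, a ∈ L ↔ a ∈ F ∧ IsIntegral K a ∧ (minpoly K a).Separable)
    (hLF : ∀ a : Ω, a ∈ L → a ∈ F) (hLN : L ≤ N) (hFE : F ≤ E) (hNE : ∀ a ∈ N, a ∈ E)
    (hE : E = adjoin k ((F : Set Ω) ∪ N)) :
    ∃ e : (E ≃ₐ[k] E) →* ((F ≃ₐ[k] F) × (N ≃ₐ[K] N)),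
      Function.Injective e ∧
      (∀ σ (a : Ω) (ha : a ∈ F), ((e σ).1 ⟨a, ha⟩ : Ω) = (σ ⟨a, hFE ha⟩ : Ω)) ∧
      (∀ σ (a : Ω) (ha : a ∈ N), ((e σ).2 ⟨a, ha⟩ : Ω) = (σ ⟨a, hNE a ha⟩ : Ω)) ∧
      Set.range e = {p : (F ≃ₐ[k] F) × (N ≃ₐ[K] N) |
        ∀ a : Ω, ∀ ha : a ∈ L, (p.1 ⟨a, hLF a ha⟩ : Ω) = (p.2 ⟨a, hLN ha⟩ : Ω)} := by
  let _ : Algebra F E := (inclusion hFE).toAlgebra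
  have : IsScalarTower k F E := IsScalarTower.of_algebraMap_eq fun _ ↦ rfl
  let _ : Algebra N E := ((algebraMap N Ω).codRestrict E fun a ↦ hNE a a.2).toAlgebra
  have : IsScalarTower K N E := IsScalarTower.of_algebraMap_eq fun _ ↦ rfl
  have h₁ (σ : E ≃ₐ[k] E) (a : Ω) (ha : a ∈ F) :
      (AlgEquiv.restrictNormalHom F σ ⟨a, ha⟩ : Ω) = σ ⟨a, hFE ha⟩ :=
    congrArg Subtype.val (σ.restrictNormal_commutes F ⟨a, ha⟩)
  have h₂ (σ : E ≃ₐ[k] E) (a : Ω) (ha : a ∈ N) :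
      (restrictNormalOverHom K k N E σ ⟨a, ha⟩ : Ω) = σ ⟨a, hNE a ha⟩ :=
    congrArg Subtype.val (algebraMap_restrictNormalOverHom (K := K) σ (⟨a, ha⟩ : N))
  refine ⟨(AlgEquiv.restrictNormalHom F).prod (restrictNormalOverHom K k N E), ?_, h₁, h₂, ?_⟩
  · intro σ τ h
    obtain ⟨hF, hN⟩ := Prod.ext_iff.1 h
    apply AlgEquiv.coe_toAlgHom_injective
    refine algHom_ext_of_eq_adjoin k hE fun x hx ↦ Subtype.ext ?_
    rcases hx with hx | hx
    · exact (h₁ σ x hx).symm.trans ((congrArg (fun f ↦ (f ⟨x, hx⟩ : Ω)) hF).trans (h₁ τ x hx))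
    · exact (h₂ σ x hx).symm.trans ((congrArg (fun f ↦ (f ⟨x, hx⟩ : Ω)) hN).trans (h₂ τ x hx))
  · ext ⟨h, g⟩
    constructor
    · rintro ⟨σ, hσ⟩ a ha
      rw [← hσ]
      exact (h₁ σ a _).trans (h₂ σ a _).symm
    · intro hp
      obtain ⟨σ, rfl⟩ := AlgEquiv.restrictNormalHom_surjective (F := k) (K₁ := F) E h
      obtain ⟨τ, hτF, hτ⟩ := exists_mem_fixingSubgroup_restrictNormalOverHom_eq (k := k) (E := E)
        (restrict hFE) ((restrictNormalOverHom K k N E σ)⁻¹ * g) (fun a ha ↦ by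
          have haF : (a : Ω) ∈ F := (mem_restrict hFE _).1 ha
          have haL : (a : Ω) ∈ L := by
            refine (hL a).2 ⟨haF, (Algebra.IsIntegral.isIntegral a).map N.val, ?_⟩
            exact IsSeparable.map N.val Subtype.val_injective (Algebra.IsSeparable.isSeparable K a)
          rw [AlgEquiv.mul_apply, AlgEquiv.aut_inv, AlgEquiv.symm_apply_eq]
          exact Subtype.ext (((hp a haL).symm.trans (h₁ σ a haF)).trans (h₂ σ a a.2).symm))
      refine ⟨σ * τ, Prod.ext ?_ ?_⟩
      · ext ⟨a, ha⟩
        refine (h₁ _ a ha).trans (.trans ?_ (h₁ σ a ha).symm)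
        rw [AlgEquiv.mul_apply, (mem_fixingSubgroup_iff _ _).1 hτF _ ((mem_restrict hFE _).2 ha)]
      · change restrictNormalOverHom K k N E (σ * τ) = g
        rw [map_mul, hτ, mul_inv_cancel_left]

end

set_option synthInstance.maxHeartbeats 1000000 in
set_option maxHeartbeats 1000000 in
/-- Let `F/K(x)` be finite Galois with `L = F ∩ K_s` (the elements of
`F` that are separable algebraic over `K`), and let `N/K` be a Galois extension
containing `L`.  Then `σ ↦ (σ|_F, σ|_N)` gives a natural isomorphism
`Gal(FN/K(x)) ≅ Gal(F/K(x)) ×_{Gal(L/K)} Gal(N/K)`: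
there is an injective homomorphism from `Gal(FN/K(x))` to the product
`Gal(F/K(x)) × Gal(N/K)` given by restrictions, whose range is exactly the fiber
product, i.e. the set of pairs agreeing on `L`. -/
theorem galois_group_compositum_fiber_product
    (K : Type) [Field K]
    (F : IntermediateField (RatFunc K) (Omega K))
    [FiniteDimensional (RatFunc K) ↥F] [IsGalois (RatFunc K) ↥F]
    (L N : IntermediateField K (Omega K))
    (hL : ∀ a : Omega K, a ∈ L ↔ a ∈ F ∧ IsIntegral K a ∧ (minpoly K a).Separable)
    (hLF : ∀ a : Omega K, a ∈ L → a ∈ F)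
    [IsGalois K ↥N] (hNalg : Algebra.IsAlgebraic K ↥N)
    (hLN : L ≤ N) :
    ∃ e : (↥(F ⊔ IntermediateField.adjoin (RatFunc K) (N : Set (Omega K)))
            ≃ₐ[RatFunc K]
          ↥(F ⊔ IntermediateField.adjoin (RatFunc K) (N : Set (Omega K)))) →*
          ((↥F ≃ₐ[RatFunc K] ↥F) × (↥N ≃ₐ[K] ↥N)),
      Function.Injective e ∧
      -- the first component is restriction to `F`
      (∀ σ (a : Omega K) (ha : a ∈ F),
        ((e σ).1 ⟨a, ha⟩ : Omega K) =
          (σ ⟨a, (SetLike.le_def.mp le_sup_left) ha⟩ : Omega K)) ∧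
      -- the second component is restriction to `N`
      (∀ σ (a : Omega K) (ha : a ∈ N),
        ((e σ).2 ⟨a, ha⟩ : Omega K) =
          (σ ⟨a, (SetLike.le_def.mp le_sup_right) (IntermediateField.subset_adjoin _ _ ha)⟩
            : Omega K)) ∧
      -- the range is the fiber product over `Gal(L/K)`
      (Set.range e = {p : (↥F ≃ₐ[RatFunc K] ↥F) × (↥N ≃ₐ[K] ↥N) |
        ∀ a : Omega K, ∀ ha : a ∈ L,
          ((p.1 ⟨a, hLF a ha⟩ : Omega K) = (p.2 ⟨a, hLN ha⟩ : Omega K))}) := by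
  have : @IsScalarTower K (RatFunc K) (Omega K) Algebra.toSMul Algebra.toSMul Algebra.toSMul :=
    IsScalarTower.of_algebraMap_eq fun _ ↦ rfl
  have := N.isGalois_adjoin_of_isGalois (k := RatFunc K)
  have : IsGalois (RatFunc K)
      ↥(F ⊔ IntermediateField.adjoin (RatFunc K) (N : Set (Omega K))) := {}
  exact IntermediateField.exists_injective_restrict_prod F _ L N hL hLF hLN _ _
    (by rw [IntermediateField.adjoin_union, IntermediateField.adjoin_self])

end
end

section
/- Let K be an infinite field, F/K(x) a finite Galois extension with L = F ∩ K_s. Then there exists a finite separable extension N₀/K such that for every Galois extension N/K containing N₀L, the quotient map β : Gal(F/K(x)) ×_{Gal(L/K)} Gal(N/K) → Gal(N/K) of the fiber product splits. -/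
noncomputable section

open Polynomial IntermediateField

theorem exists_isIntegral_generator_conductor (A k B F : Type*) [CommRing A] [IsDomain A]
    [IsIntegrallyClosed A] [Field k] [Algebra A k] [IsFractionRing A k] [Field F] [Algebra k F]
    [FiniteDimensional k F] [Algebra.IsSeparable k F] [Algebra A F] [IsScalarTower A k F]
    [CommRing B] [IsDomain B] [Algebra A B] [Algebra B F] [IsScalarTower A B F]
    [IsIntegralClosure B A F] :
    ∃ (θ : B) (c : A), c ≠ 0 ∧ (∀ b : B, c • b ∈ Algebra.adjoin A {θ}) ∧
      aeval θ (derivative (minpoly A θ)) ∣ algebraMap A B c := by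
  have hAk : Function.Injective (algebraMap A k) := IsFractionRing.injective A k
  have hBF : Function.Injective (algebraMap B F) := IsIntegralClosure.algebraMap_injective B A F
  have hAF : Function.Injective (algebraMap A F) := by
    rw [IsScalarTower.algebraMap_eq A k F]
    exact (algebraMap k F).injective.comp hAk
  have hAB : Function.Injective (algebraMap A B) := by
    rw [IsScalarTower.algebraMap_eq A B F] at hAF
    exact Function.Injective.of_comp hAF
  have : FaithfulSMul A B := (faithfulSMul_iff_algebraMap_injective A B).2 hAB
  have : FaithfulSMul B F := (faithfulSMul_iff_algebraMap_injective B F).2 hBF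
  have hint : Algebra.IsIntegral A B := IsIntegralClosure.isIntegral_algebra A F
  obtain ⟨α, hα⟩ : ∃ α : F, Algebra.adjoin k {α} = ⊤ :=
    ⟨_, (Field.powerBasisOfFiniteOfSeparable k F).adjoin_gen_eq_top⟩
  have halg : IsAlgebraic A α :=
    (IsFractionRing.isAlgebraic_iff A k F).2 (Algebra.IsAlgebraic.isAlgebraic α)
  obtain ⟨y, hy, hyint⟩ := halg.exists_integral_multiple
  obtain ⟨θ, hθ⟩ := (IsIntegralClosure.isIntegral_iff (A := B)).1 hyint
  have htop : Algebra.adjoin k {algebraMap B F θ} = ⊤ := by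
    rw [eq_top_iff, ← hα, Algebra.adjoin_le_iff, Set.singleton_subset_iff]
    have h : α = (algebraMap A k y)⁻¹ • algebraMap B F θ := by
      rw [hθ, ← algebraMap_smul k y α, smul_smul, inv_mul_cancel₀, one_smul]
      exact fun h => hy (hAk (by simpa using h))
    rw [h]
    exact Subalgebra.smul_mem _ (Algebra.subset_adjoin (Set.mem_singleton (algebraMap B F θ))) _
  have hθk : IsIntegral k (algebraMap B F θ) := Algebra.IsIntegral.isIntegral _
  obtain ⟨pb, hgen⟩ : ∃ pb : PowerBasis k F, pb.gen = algebraMap B F θ :=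
    ⟨_, PowerBasis.ofAdjoinEqTop_gen hθk htop⟩
  have hgenint : IsIntegral A pb.gen := by
    rw [hgen]; exact (hint.isIntegral θ).algebraMap
  have hdint : IsIntegral A (Algebra.discr k pb.basis) :=
    Algebra.discr_isIntegral k fun i => by
      rw [PowerBasis.basis_eq_pow]; exact hgenint.pow _
  obtain ⟨d, hd⟩ := IsIntegrallyClosed.algebraMap_eq_of_integral hdint
  have hd0 : d ≠ 0 := by
    rintro rfl
    exact Algebra.discr_not_zero_of_basis k pb.basis (by rw [← hd, map_zero])
  have hmem (b : B) : d • b ∈ Algebra.adjoin A {θ} := by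
    have h := Algebra.discr_mul_isIntegral_mem_adjoin k hgenint
      ((hint.isIntegral b).algebraMap (B := F))
    rw [← hd, algebraMap_smul, hgen, ← Set.image_singleton, ← IsScalarTower.coe_toAlgHom' A B F,
      ← AlgHom.map_adjoin, ← map_smul] at h
    obtain ⟨z, hz, hzb⟩ := h
    rwa [← hBF hzb]
  have hsep : aeval θ (derivative (minpoly A θ)) ≠ 0 := by
    intro h0
    have hs := (Algebra.IsSeparable.isSeparable k (algebraMap B F θ)).aeval_derivative_ne_zero
      (minpoly.aeval k (algebraMap B F θ))
    rw [minpoly.isIntegrallyClosed_eq_field_fractions k F (hint.isIntegral θ), derivative_map,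
      aeval_map_algebraMap, aeval_algebraMap_apply, h0, map_zero] at hs
    exact hs rfl
  obtain ⟨e, he, hdvd⟩ :=
    (hint.isIntegral (aeval θ (derivative (minpoly A θ)))).isAlgebraic.exists_nonzero_dvd
      (mem_nonZeroDivisors_of_ne_zero hsep)
  refine ⟨θ, e * d, mul_ne_zero he hd0, fun b => ?_, ?_⟩
  · rw [mul_smul]
    exact Subalgebra.smul_mem _ (hmem b) e
  · rw [map_mul]
    exact hdvd.mul_right _

theorem existsUnique_algEquiv_comp_eq {A B Ω : Type*} [CommRing A] [CommRing B] [IsDomain B]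
    [Algebra A B] [Finite (B ≃ₐ[A] B)] [Algebra.IsInvariant A B (B ≃ₐ[A] B)] [Field Ω]
    {θ : B} {c : A} (hc : ∀ b : B, c • b ∈ Algebra.adjoin A {θ})
    (hdvd : aeval θ (derivative (minpoly A θ)) ∣ algebraMap A B c)
    {ψ ψ' : B →+* Ω} (h : ψ'.comp (algebraMap A B) = ψ.comp (algebraMap A B))
    (hψc : ψ (algebraMap A B c) ≠ 0) :
    ∃! σ : B ≃ₐ[A] B, ∀ b, ψ' b = ψ (σ b) := by
  have h' (a : A) : ψ' (algebraMap A B a) = ψ (algebraMap A B a) := congr($h a)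
  have hθ : IsIntegral A θ := (Algebra.IsInvariant.isIntegral A B (B ≃ₐ[A] B)).isIntegral θ
  have key (σ : B ≃ₐ[A] B) (hσ : ψ' θ = ψ (σ θ)) (b : B) : ψ' b = ψ (σ b) := by
    have hadj : ∀ z ∈ Algebra.adjoin A {θ}, ψ' z = ψ (σ z) := by
      intro z hz
      induction hz using Algebra.adjoin_induction with
      | mem x hx => rw [Set.mem_singleton_iff.1 hx, hσ]
      | algebraMap r => rw [σ.commutes, h']
      | add x y _ _ hx hy => simp only [map_add, hx, hy]
      | mul x y _ _ hx hy => simp only [map_mul, hx, hy]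
    have hcb := hadj _ (hc b)
    rw [Algebra.smul_def, map_mul, map_mul, map_mul, σ.commutes, h'] at hcb
    exact mul_left_cancel₀ hψc hcb
  cases nonempty_fintype (B ≃ₐ[A] B)
  obtain ⟨P, hP⟩ := Algebra.IsInvariant.charpoly_mem_lifts A B (B ≃ₐ[A] B) θ
  have hroot : ∃ σ : B ≃ₐ[A] B, ψ' θ = ψ (σ θ) := by
    have h0 : eval₂ ψ' (ψ' θ) (P.map (algebraMap A B)) = 0 := by
      rw [← coe_mapRingHom, hP, eval₂_at_apply, MulSemiringAction.eval_charpoly, map_zero]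
    rw [eval₂_map, h, ← eval₂_map, ← coe_mapRingHom, hP, MulSemiringAction.charpoly_eq,
      eval₂_finsetProd, Finset.prod_eq_zero_iff] at h0
    obtain ⟨σ, -, hσ⟩ := h0
    exact ⟨σ, by simpa [sub_eq_zero] using hσ⟩
  obtain ⟨σ, hσ⟩ := hroot
  refine ⟨σ, key σ hσ, fun τ hτ => ?_⟩
  have heq : σ θ = τ θ := by
    by_contra hne
    have hr (ρ : B ≃ₐ[A] B) : ((minpoly A θ).map (algebraMap A B)).eval (ρ θ) = 0 := by
      rw [eval_map_algebraMap, aeval_algHom_apply ρ, minpoly.aeval, map_zero]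
    obtain ⟨q, hq⟩ := dvd_iff_isRoot.2 (hr σ)
    have hq0 : q.eval (τ θ) = 0 := by
      have := hr τ
      rw [hq, eval_mul, eval_sub, eval_X, eval_C, mul_eq_zero] at this
      exact this.resolve_left fun h => hne (sub_eq_zero.1 h).symm
    have hder : ψ (aeval (τ θ) (derivative (minpoly A θ))) = 0 := by
      rw [← eval_map_algebraMap, ← derivative_map, hq, derivative_mul]
      simp [hq0, ← hτ, ← hσ]
    obtain ⟨e, he⟩ := hdvd
    apply hψc
    rw [← τ.commutes, he, map_mul, ← aeval_algHom_apply τ, map_mul, hder, zero_mul]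
  ext b
  have hadj : ∀ z ∈ Algebra.adjoin A {θ}, τ z = σ z := by
    intro z hz
    induction hz using Algebra.adjoin_induction with
    | mem x hx => rw [Set.mem_singleton_iff.1 hx, heq]
    | algebraMap r => simp
    | add x y _ _ hx hy => simp only [map_add, hx, hy]
    | mul x y _ _ hx hy => simp only [map_mul, hx, hy]
  have hcb := hadj _ (hc b)
  rw [Algebra.smul_def, map_mul, map_mul, σ.commutes, τ.commutes] at hcb
  exact mul_left_cancel₀ (fun h0 => hψc (by rw [h0, map_zero])) hcb

theorem isIntegral_and_separable_minpoly_of_simple_root {K Ω : Type*} [Field K] [Field Ω] [Algebra K Ω]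
    {g : K[X]} {z : Ω} (hg : g.Monic) (h0 : aeval z g = 0) (h1 : aeval z (derivative g) ≠ 0) :
    IsIntegral K z ∧ (minpoly K z).Separable := by
  have hz : IsIntegral K z := ⟨g, hg, h0⟩
  refine ⟨hz, (separable_iff_derivative_ne_zero (minpoly.irreducible hz)).2 fun hd => h1 ?_⟩
  obtain ⟨q, hq⟩ := minpoly.dvd K z h0
  rw [hq, derivative_mul, hd]
  simp

theorem exists_ringHom_of_eval {K B L Ω : Type*} [Field K] [CommRing B] [Algebra K[X] B]
    [Algebra.IsIntegral K[X] B] [FaithfulSMul K[X] B] [Field L] [Algebra K L] [Field Ω]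
    [IsAlgClosed Ω] [Algebra K Ω] (j : L →+* B) (i : L →ₐ[K] Ω)
    (hj : ∀ r, j (algebraMap K L r) = algebraMap K[X] B (C r)) (a : K) :
    ∃ ψ : B →+* Ω, (∀ p, ψ (algebraMap K[X] B p) = algebraMap K Ω (p.eval a)) ∧
      ∀ l, ψ (j l) = i l := by
  have hmax : (RingHom.ker (evalRingHom a)).IsMaximal :=
    RingHom.ker_isMaximal_of_surjective _ fun r => ⟨C r, by simp⟩
  obtain ⟨Q, hQ, hQP⟩ := Ideal.exists_ideal_over_maximal_of_isIntegral (S := B)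
    (RingHom.ker (evalRingHom a))
    (by rw [(RingHom.injective_iff_ker_eq_bot _).1 (FaithfulSMul.algebraMap_injective K[X] B)]
        exact bot_le)
  let := Ideal.Quotient.field Q
  have hmk (p : K[X]) : Ideal.Quotient.mk Q (algebraMap K[X] B p) =
      Ideal.Quotient.mk Q (j (algebraMap K L (p.eval a))) := by
    rw [hj, Ideal.Quotient.eq, ← map_sub, ← Ideal.mem_comap, hQP, RingHom.mem_ker]
    simp
  let : Algebra L (B ⧸ Q) := ((Ideal.Quotient.mk Q).comp j).toAlgebra
  let : Algebra L Ω := i.toRingHom.toAlgebra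
  have hint : Algebra.IsIntegral L (B ⧸ Q) := by
    refine ⟨fun z => ?_⟩
    obtain ⟨b, rfl⟩ := Ideal.Quotient.mk_surjective z
    obtain ⟨p, hp, hpb⟩ := Algebra.IsIntegral.isIntegral (R := K[X]) b
    refine ⟨p.map ((algebraMap K L).comp (evalRingHom a)), hp.map _, ?_⟩
    have := congr(Ideal.Quotient.mk Q $hpb)
    rw [hom_eval₂, map_zero] at this
    rw [eval₂_map, ← this]
    congr 1
    exact RingHom.ext fun p => (hmk p).symm
  let f : (B ⧸ Q) →ₐ[L] Ω := IsAlgClosed.lift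
  have hf (l : L) : f (Ideal.Quotient.mk Q (j l)) = i l := f.commutes l
  refine ⟨(f : (B ⧸ Q) →+* Ω).comp (Ideal.Quotient.mk Q), fun p => ?_, hf⟩
  change f (Ideal.Quotient.mk Q (algebraMap K[X] B p)) = _
  rw [hmk, hf, i.commutes]

theorem exists_isSeparable_le_forall_mem {K B Ω : Type*} [Field K] [CommRing B] [Algebra K[X] B]
    [Algebra.IsIntegral K[X] B] [Field Ω] [Algebra K Ω] {θ : B} {c : K[X]} {a : K}
    (hc : ∀ b : B, c • b ∈ Algebra.adjoin K[X] {θ})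
    (hdvd : aeval θ (derivative (minpoly K[X] θ)) ∣ algebraMap K[X] B c) (hca : c.eval a ≠ 0)
    {ψ : B →+* Ω} (hψ : ∀ p, ψ (algebraMap K[X] B p) = algebraMap K Ω (p.eval a)) :
    ∃ N₀ : IntermediateField K Ω, FiniteDimensional K N₀ ∧ Algebra.IsSeparable K N₀ ∧
      ∀ b, ψ b ∈ N₀ := by
  have haeval (f : K[X][X]) : aeval (ψ θ) (f.map (evalRingHom a)) = ψ (aeval θ f) := by
    rw [aeval_def, eval₂_map, aeval_def, hom_eval₂]
    congr 1
    exact RingHom.ext fun p => (hψ p).symm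
  have hcψ : ψ (algebraMap K[X] B c) ≠ 0 := by
    rw [hψ]; simpa using hca
  obtain ⟨hint, hsep⟩ := isIntegral_and_separable_minpoly_of_simple_root
    ((minpoly.monic (Algebra.IsIntegral.isIntegral (R := K[X]) θ)).map (evalRingHom a))
    (by rw [haeval, minpoly.aeval, map_zero])
    (by
      rw [derivative_map, haeval]
      obtain ⟨e, he⟩ := hdvd
      intro h0
      exact hcψ (by rw [he, map_mul, h0, zero_mul]))
  refine ⟨K⟮ψ θ⟯, IntermediateField.adjoin.finiteDimensional hint,
    IntermediateField.isSeparable_adjoin_simple_iff_isSeparable K Ω |>.2 hsep, fun b => ?_⟩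
  have hadj : ∀ z ∈ Algebra.adjoin K[X] {θ}, ψ z ∈ K⟮ψ θ⟯ := by
    intro z hz
    induction hz using Algebra.adjoin_induction with
    | mem x hx =>
      rw [Set.mem_singleton_iff.1 hx]
      exact IntermediateField.mem_adjoin_simple_self K _
    | algebraMap r => rw [hψ]; exact IntermediateField.algebraMap_mem _ _
    | add x y _ _ hx hy => rw [map_add]; exact add_mem hx hy
    | mul x y _ _ hx hy => rw [map_mul]; exact mul_mem hx hy
  have hcb := hadj _ (hc b)
  rw [Algebra.smul_def, map_mul] at hcb
  rw [← inv_mul_cancel_left₀ hcψ (ψ b)]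
  refine mul_mem (inv_mem ?_) hcb
  rw [hψ]
  exact IntermediateField.algebraMap_mem _ _

/-- The monoid homomorphism `τ ↦ σ` determined by `τ ∘ ψ = ψ ∘ σ`. -/
theorem exists_monoidHom_semiconj {A B Ω G : Type*} [CommRing A] [CommRing B] [Algebra A B]
    [Monoid G] [Semiring Ω] [MulSemiringAction G Ω] (ψ : B →+* Ω)
    (h : ∀ τ : G, ∃! σ : B ≃ₐ[A] B, ∀ b, τ • ψ b = ψ (σ b)) :
    ∃ s : G →* (B ≃ₐ[A] B), ∀ τ b, τ • ψ b = ψ (s τ b) := by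
  choose s hs huniq using fun τ => (h τ)
  refine ⟨⟨⟨s, ?_⟩, ?_⟩, hs⟩
  · exact (huniq 1 1 fun b => by simp).symm
  · exact fun τ τ' => (huniq (τ * τ') (s τ * s τ') fun b => by
      rw [mul_smul, hs τ' b, hs τ, AlgEquiv.mul_apply]).symm

set_option synthInstance.maxHeartbeats 1000000 in
set_option maxHeartbeats 1000000 in
/-- Let `K` be an infinite field, `F/K(x)` a finite Galois extension
with `L = F ∩ K_s`.  Then there is a finite separable extension `N₀/K` such that for
every Galois extension `N/K` containing `N₀` and `L`, the quotient map
`β : Gal(F/K(x)) ×_{Gal(L/K)} Gal(N/K) → Gal(N/K)` of the fiber product splits.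
(A section of `β` is the same as a homomorphism `Gal(N/K) → Gal(F/K(x))` agreeing with
the identity on `L`; this is how the splitting is expressed below.) -/
theorem fiber_product_quotient_splits
    (K : Type) [Field K] [Infinite K]
    (F : IntermediateField (RatFunc K) (Omega K))
    [FiniteDimensional (RatFunc K) ↥F] [IsGalois (RatFunc K) ↥F]
    (L : IntermediateField K (Omega K))
    (hL : ∀ a : Omega K, a ∈ L ↔ a ∈ F ∧ IsIntegral K a ∧ (minpoly K a).Separable)
    (hLF : ∀ a : Omega K, a ∈ L → a ∈ F) :
    ∃ N₀ : IntermediateField K (Omega K),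
      FiniteDimensional K ↥N₀ ∧ Algebra.IsSeparable K ↥N₀ ∧
      ∀ N : IntermediateField K (Omega K), IsGalois K ↥N → Algebra.IsAlgebraic K ↥N →
        ∀ (_ : N₀ ≤ N) (hLN : L ≤ N),
        ∃ s : (↥N ≃ₐ[K] ↥N) →* (↥F ≃ₐ[RatFunc K] ↥F),
          ∀ (τ : ↥N ≃ₐ[K] ↥N) (a : Omega K) (ha : a ∈ L),
            ((s τ) ⟨a, hLF a ha⟩ : Omega K) = (τ ⟨a, hLN ha⟩ : Omega K) := by
  have hKX (r : K) : algebraMap K[X] (Omega K) (C r) = algebraMap K (Omega K) r := by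
    rw [IsScalarTower.algebraMap_apply K[X] (RatFunc K) (Omega K)]
    rfl
  have : IsScalarTower K[X] F (Omega K) := IsScalarTower.of_algebraMap_eq fun _ => rfl
  let B := integralClosure K[X] F
  have : IsFractionRing B F :=
    IsIntegralClosure.isFractionRing_of_finite_extension K[X] (RatFunc K) F B
  have hinv : Algebra.IsInvariant K[X] B (B ≃ₐ[K[X]] B) :=
    Algebra.isInvariant_of_isGalois' K[X] (RatFunc K) F B
  have : Finite (B ≃ₐ[K[X]] B) :=
    Finite.of_equiv _ (galRestrict K[X] (RatFunc K) F B).toEquiv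
  have hintB : Algebra.IsIntegral K[X] B := IsIntegralClosure.isIntegral_algebra K[X] F
  have : FaithfulSMul K[X] B := (faithfulSMul_iff_algebraMap_injective _ _).2
    fun p q h => by
      have h : algebraMap (RatFunc K) (Omega K) (algebraMap K[X] (RatFunc K) p) =
          algebraMap (RatFunc K) (Omega K) (algebraMap K[X] (RatFunc K) q) :=
        congr(((($h : B) : F) : Omega K))
      exact IsFractionRing.injective K[X] (RatFunc K)
        ((algebraMap (RatFunc K) (Omega K)).injective h)
  obtain ⟨θ, c, hc0, hc, hdvd⟩ := exists_isIntegral_generator_conductor K[X] (RatFunc K) B F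
  obtain ⟨a, ha⟩ : ∃ a : K, c.eval a ≠ 0 := by
    by_contra! h
    exact hc0 (Polynomial.funext fun r => by simpa using h r)
  have hLint (l : Omega K) (hl : l ∈ L) : (⟨l, hLF l hl⟩ : F) ∈ B := by
    obtain ⟨-, hint, -⟩ := (hL l).1 hl
    have : IsIntegral K[X] l := by
      refine ⟨(minpoly K l).map C, (minpoly.monic hint).map C, ?_⟩
      rw [eval₂_map, ← minpoly.aeval K l, aeval_def]
      exact congrArg (fun f => eval₂ f l (minpoly K l)) (RingHom.ext hKX)
    exact (isIntegral_algHom_iff (IsScalarTower.toAlgHom K[X] F (Omega K))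
      (algebraMap F (Omega K)).injective).1 this
  let j : L →+* B :=
    { toFun l := ⟨⟨l, hLF l l.2⟩, hLint l l.2⟩
      map_one' := rfl
      map_mul' _ _ := rfl
      map_zero' := rfl
      map_add' _ _ := rfl }
  obtain ⟨ψ, hψ, hψj⟩ := exists_ringHom_of_eval (B := B) j L.val
    (fun r => Subtype.ext (Subtype.ext (hKX r).symm)) a
  obtain ⟨N₀, hfin, hsep, hN₀⟩ := exists_isSeparable_le_forall_mem hc hdvd ha hψ
  refine ⟨N₀, hfin, hsep, fun N _ _ hN₀N hLN => ?_⟩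
  let ψN : B →+* N := ψ.codRestrict N.toSubring fun b => hN₀N (hN₀ b)
  have hψN (p : K[X]) : ψN (algebraMap K[X] B p) = algebraMap K N (p.eval a) :=
    Subtype.ext (hψ p)
  obtain ⟨s, hs⟩ := exists_monoidHom_semiconj (A := K[X]) (G := N ≃ₐ[K] N) ψN fun τ =>
    existsUnique_algEquiv_comp_eq (ψ' := (τ : N →+* N).comp ψN) hc hdvd
      (RingHom.ext fun p => by
        change τ (ψN (algebraMap K[X] B p)) = ψN (algebraMap K[X] B p)
        rw [hψN, τ.commutes])
      (by rw [hψN]; simpa using ha)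
  refine ⟨(galRestrict K[X] (RatFunc K) F B).symm.toMonoidHom.comp s, fun τ l hl => ?_⟩
  have hsl : (galRestrict K[X] (RatFunc K) F B).symm (s τ) ⟨l, hLF l hl⟩ =
      (s τ (j ⟨l, hl⟩) : F) :=
    galRestrict_symm_algebraMap_apply K[X] (RatFunc K) (s τ) (j ⟨l, hl⟩)
  change (((galRestrict K[X] (RatFunc K) F B).symm (s τ) ⟨l, hLF l hl⟩ : F) : Omega K) = _
  rw [hsl]
  obtain ⟨-, hint, hlsep⟩ := (hL l).1 hl
  have hmem : ((s τ (j ⟨l, hl⟩) : F) : Omega K) ∈ L := by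
    let g : L →ₐ[K] Omega K :=
      { (algebraMap F (Omega K)).comp ((algebraMap B F).comp ((s τ : B →+* B).comp j)) with
        commutes' r := by
          have h : j (algebraMap K L r) = algebraMap K[X] B (C r) :=
            Subtype.ext (Subtype.ext (hKX r).symm)
          change (((s τ (j (algebraMap K L r)) : B) : F) : Omega K) = _
          rw [h, (s τ).commutes]
          exact hKX r }
    have hmin : minpoly K (g ⟨l, hl⟩) = minpoly K l :=
      (minpoly.algHom_eq g g.injective _).trans (minpoly.algHom_eq L.val L.val.injective _).symm
    have hgint : IsIntegral K (⟨l, hl⟩ : L) := (isIntegral_algHom_iff L.val L.val.injective).1 hint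
    exact (hL _).2 ⟨(s τ (j ⟨l, hl⟩) : F).2, hgint.map g, hmin ▸ hlsep⟩
  have h1 := hψj ⟨_, hmem⟩
  have h2 := congr(($(hs τ (j ⟨l, hl⟩)) : Omega K))
  have h3 : ψN (j ⟨l, hl⟩) = ⟨l, hLN hl⟩ := Subtype.ext (hψj ⟨l, hl⟩)
  rw [h3] at h2
  exact (h2.trans h1).symm

end
end

section
/- Let E be a field of characteristic p > 0 with a discrete (normalized) valuation v, and let F/E be a Galois extension of degree p. Then v is totally ramified in F if and only if there exist a ∈ E and x ∈ F with F = E(x), x^p − x = a, v(a) < 0, and p ∤ v(a). -/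
/-- A (normalized) discrete valuation `v` on `E` is totally ramified in the degree-`p`
extension `F`: there is a normalized discrete valuation `w` of `F` whose restriction to
`E` is `e · v` with ramification index `e = p`. -/
def TotallyRamifiedIn {E F : Type} [Field E] [Field F] [Algebra E F]
    (v : AddValuation E (WithTop ℤ)) (p : ℕ) : Prop :=
  ∃ w : AddValuation F (WithTop ℤ),
    (∃ t : F, w t = (1 : ℤ)) ∧ ∀ b : E, w (algebraMap E F b) = p • v b

open Finset in
/-- The value of a finite sum whose nonzero terms have pairwise distinct values is the value of
one of its nonzero terms. -/
theorem AddValuation.exists_map_sum_eq_of_distinct {F ι Γ : Type*} [Field F]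
    [LinearOrderedAddCommGroupWithTop Γ] (w : AddValuation F Γ) (u : ι → F)
    (s : Finset ι) (hu : ∀ i ∈ s, ∀ j ∈ s, i ≠ j → u i ≠ 0 → w (u i) ≠ w (u j))
    (hne : ∃ i ∈ s, u i ≠ 0) : ∃ i ∈ s, u i ≠ 0 ∧ w (∑ i ∈ s, u i) = w (u i) := by
  classical
  induction s using Finset.induction_on with
  | empty => simp at hne
  | insert k s hk ih =>
    rw [sum_insert hk]
    by_cases hs : ∃ i ∈ s, u i ≠ 0
    · obtain ⟨i, his, hi0, hi⟩ := ih
        (fun i hi j hj => hu i (mem_insert_of_mem hi) j (mem_insert_of_mem hj)) hs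
      have hik : w (u k) ≠ w (∑ i ∈ s, u i) := by
        rw [hi]
        exact (hu i (mem_insert_of_mem his) k (mem_insert_self k s)
          (fun h => hk (h ▸ his)) hi0).symm
      rcases lt_or_gt_of_ne hik with h | h
      · refine ⟨k, mem_insert_self k s, fun hk0 => ?_, w.map_add_eq_of_lt_left h⟩
        rw [hk0, w.map_zero] at h
        exact not_top_lt h
      · exact ⟨i, mem_insert_of_mem his, hi0, (w.map_add_eq_of_lt_right h).trans hi⟩
    · push Not at hs
      rw [sum_eq_zero hs, add_zero]
      obtain ⟨i, hi, hi0⟩ := hne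
      rcases mem_insert.1 hi with rfl | hi
      · exact ⟨i, mem_insert_self i s, hi0, rfl⟩
      · exact absurd (hs i hi) hi0

/-- An integer-valued additive valuation on a field takes an integer value at a nonzero element. -/
theorem AddValuation.exists_eq_coe {K : Type*} [Field K] (v : AddValuation K (WithTop ℤ))
    {c : K} (hc : c ≠ 0) : ∃ m : ℤ, v c = (m : WithTop ℤ) := by
  obtain ⟨m, hm⟩ := WithTop.ne_top_iff_exists.1 ((v.ne_top_iff).2 hc)
  exact ⟨m, hm.symm⟩

/-- A normalized additive valuation takes every integer value. -/
theorem AddValuation.exists_map_eq_of_normalized {K : Type*} [Field K]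
    (v : AddValuation K (WithTop ℤ)) (hv : ∃ π : K, v π = (1 : ℤ)) (m : ℤ) :
    ∃ c : K, v c = (m : WithTop ℤ) := by
  obtain ⟨π, hπ⟩ := hv
  have hpow (k : ℕ) : v (π ^ k) = ((k : ℤ) : WithTop ℤ) := by
    rw [v.map_pow, hπ, ← WithTop.coe_nsmul]
    simp
  obtain ⟨k, rfl | rfl⟩ := m.eq_nat_or_neg
  · exact ⟨π ^ k, hpow k⟩
  · exact ⟨(π ^ k)⁻¹, by rw [v.map_inv, hpow k]; rfl⟩

/-- A Galois extension of degree `p` in characteristic `p` is generated by a root of an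
Artin–Schreier polynomial. -/
theorem exists_artinSchreier_generator (E F : Type*) [Field E] [Field F] [Algebra E F]
    [IsGalois E F] (p : ℕ) [hp : Fact p.Prime] [CharP E p] (hdeg : Module.finrank E F = p) :
    ∃ (a : E) (x : F), x ∉ Set.range (algebraMap E F) ∧ x ^ p - x = algebraMap E F a := by
  have : FiniteDimensional E F := Module.finite_of_finrank_pos (hdeg ▸ hp.1.pos)
  have : CharP F p := charP_of_injective_algebraMap (algebraMap E F).injective p
  have hcard : Nat.card (F ≃ₐ[E] F) = p := (IsGalois.card_aut_eq_finrank E F).trans hdeg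
  have : Nontrivial (F ≃ₐ[E] F) := Finite.one_lt_card_iff_nontrivial.1 (hcard ▸ hp.1.one_lt)
  obtain ⟨σ, hσ⟩ := exists_ne (1 : F ≃ₐ[E] F)
  have hfix (y : F) (hy : σ y = y) : y ∈ Set.range (algebraMap E F) := by
    refine (IsGalois.mem_range_algebraMap_iff_fixed y).2 fun τ => ?_
    obtain ⟨k, rfl⟩ := Subgroup.mem_zpowers_iff.1 (mem_zpowers_of_prime_card hcard hσ (g' := τ))
    have : σ ∈ MulAction.stabilizer (F ≃ₐ[E] F) y := hy
    exact Subgroup.zpow_mem _ this k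
  let D : Module.End E F := σ.toLinearMap - 1
  have hD (y : F) : D y = σ y - y := rfl
  have hDp : D ^ p = 0 := by
    have : CharP (Module.End E F) p :=
      charP_of_injective_algebraMap (algebraMap E (Module.End E F)).injective p
    have hσp : (σ.toLinearMap : Module.End E F) ^ p = 1 := by
      have h1 (k : ℕ) (y : F) : ((σ.toLinearMap : Module.End E F) ^ k) y = (σ ^ k) y := by
        induction k generalizing y with
        | zero => simp
        | succ k ih => rw [pow_succ, pow_succ, Module.End.mul_apply, ih]; rfl
      ext y
      have h2 : σ ^ p = 1 := hcard ▸ pow_card_eq_one'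
      rw [h1, h2]; rfl
    rw [sub_pow_char_of_commute p (Commute.one_right _), hσp, one_pow, sub_self]
  have hD1 : D ≠ 0 := by
    intro h
    refine hσ (AlgEquiv.ext fun y => ?_)
    have := LinearMap.congr_fun h y
    rw [hD] at this
    exact sub_eq_zero.1 this
  classical
  have hex : ∃ k, D ^ k = 0 := ⟨p, hDp⟩
  obtain ⟨k, hk⟩ : ∃ k, Nat.find hex = k + 2 := by
    have h0 : Nat.find hex ≠ 0 := fun h => by
      have := Nat.find_spec hex
      rw [h, pow_zero] at this
      exact one_ne_zero this
    have h1 : Nat.find hex ≠ 1 := fun h => by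
      have := Nat.find_spec hex
      rw [h, pow_one] at this
      exact hD1 this
    exact ⟨Nat.find hex - 2, by omega⟩
  have hk2 : D ^ (k + 2) = 0 := hk ▸ Nat.find_spec hex
  have hk1 : D ^ (k + 1) ≠ 0 := Nat.find_min hex (by omega)
  obtain ⟨y, hy⟩ : ∃ y, (D ^ (k + 1)) y ≠ 0 := by
    by_contra! h
    exact hk1 (LinearMap.ext h)
  set z := (D ^ k) y
  have hz : (D ^ (k + 1)) y = D z := by rw [pow_succ', Module.End.mul_apply]
  have hDz : σ (D z) = D z := by
    have : D (D z) = 0 := by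
      rw [← hz, ← Module.End.mul_apply, ← pow_succ', hk2]; rfl
    rwa [hD, sub_eq_zero] at this
  have hz0 : D z ≠ 0 := hz ▸ hy
  have hx : σ (z / D z) = z / D z + 1 := by
    rw [map_div₀, hDz, eq_comm, div_add_one hz0, hD, add_sub_cancel]
  obtain ⟨a, ha⟩ := hfix ((z / D z) ^ p - z / D z) (by
    rw [map_sub, map_pow, hx, add_pow_char, one_pow, add_sub_add_right_eq_sub])
  refine ⟨a, z / D z, ?_, ha.symm⟩
  rintro ⟨c, hc⟩
  rw [← hc, σ.commutes] at hx
  simp at hx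

/-- A totally ramified Galois extension of degree `p` has an Artin–Schreier generator of negative
value prime to `p`. -/
theorem TotallyRamifiedIn.exists_generator {E F : Type} [Field E] [Field F] [Algebra E F]
    [IsGalois E F] {p : ℕ} [hp : Fact p.Prime] [CharP E p] (hdeg : Module.finrank E F = p)
    {v : AddValuation E (WithTop ℤ)} (h : TotallyRamifiedIn (F := F) v p) :
    ∃ (a : E) (x : F), IntermediateField.adjoin E {x} = ⊤ ∧ x ^ p - x = algebraMap E F a ∧
      v a < 0 ∧ ∃ n : ℤ, v a = (n : WithTop ℤ) ∧ ¬ ((p : ℤ) ∣ n) := by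
  obtain ⟨w, ⟨t, ht⟩, hw⟩ := h
  obtain ⟨a, x, hx, hxa⟩ := exists_artinSchreier_generator E F p hdeg
  have : FiniteDimensional E F := Module.finite_of_finrank_pos (hdeg ▸ hp.1.pos)
  have : CharP F p := charP_of_injective_algebraMap (algebraMap E F).injective p
  have hpZ : (0 : ℤ) < p := mod_cast hp.1.pos
  have hterm (c : E) (hc : c ≠ 0) (i : ℕ) :
      ∃ m : ℤ, w (c • t ^ i) = ((p * m + i : ℤ) : WithTop ℤ) := by
    obtain ⟨m, hm⟩ := v.exists_eq_coe hc
    refine ⟨m, ?_⟩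
    rw [Algebra.smul_def, w.map_mul, hw, hm, w.map_pow, ht, ← WithTop.coe_nsmul,
      ← WithTop.coe_nsmul, ← WithTop.coe_add]
    simp
  have hdist (c : Fin p → E) (i j : Fin p) (hij : i ≠ j) (hi : c i • t ^ (i : ℕ) ≠ 0) :
      w (c i • t ^ (i : ℕ)) ≠ w (c j • t ^ (j : ℕ)) := by
    have hci : c i ≠ 0 := fun h => hi (by rw [h, zero_smul])
    obtain ⟨m, hm⟩ := hterm (c i) hci i
    by_cases hcj : c j = 0
    · rw [hcj, zero_smul, w.map_zero, hm]
      exact WithTop.coe_ne_top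
    obtain ⟨m', hm'⟩ := hterm (c j) hcj j
    rw [hm, hm']
    intro h
    have h := WithTop.coe_injective h
    have h2 := congrArg (· % (p : ℤ)) h
    simp only [Int.mul_add_emod_self_left] at h2
    rw [Int.emod_eq_of_lt (by positivity) (by exact_mod_cast i.2),
      Int.emod_eq_of_lt (by positivity) (by exact_mod_cast j.2)] at h2
    exact hij (Fin.ext (by exact_mod_cast h2))
  have ht0 : t ≠ 0 := fun h => by
    rw [h, w.map_zero] at ht
    exact WithTop.top_ne_coe ht
  have hli : LinearIndependent E fun i : Fin p => t ^ (i : ℕ) := by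
    rw [Fintype.linearIndependent_iff]
    intro c hc
    by_contra! hne
    obtain ⟨i, hi⟩ := hne
    obtain ⟨j, -, hj0, hj⟩ := w.exists_map_sum_eq_of_distinct (fun i : Fin p => c i • t ^ (i : ℕ))
      Finset.univ (fun i _ j _ => hdist c i j)
      ⟨i, Finset.mem_univ i, smul_ne_zero hi (pow_ne_zero _ ht0)⟩
    rw [hc, w.map_zero, eq_comm, w.top_iff] at hj
    exact hj0 hj
  have : NeZero p := ⟨hp.1.ne_zero⟩
  let b := basisOfLinearIndependentOfCardEqFinrank hli (by simp [hdeg])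
  have hb (i : Fin p) : b i = t ^ (i : ℕ) := by simp [b]
  let c := b.repr x
  have hxsum : ∑ i : Fin p, c i • t ^ (i : ℕ) = x := by
    simpa only [hb] using b.sum_repr x
  set y := x - algebraMap E F (c 0) with hy
  have hyE : y ∉ Set.range (algebraMap E F) := by
    rintro ⟨d, hd⟩
    exact hx ⟨d + c 0, by rw [map_add, hd, hy, sub_add_cancel]⟩
  have hysum : ∑ i ∈ Finset.univ.erase (0 : Fin p), c i • t ^ (i : ℕ) = y := by
    rw [hy, ← hxsum, ← Finset.add_sum_erase _ _ (Finset.mem_univ (0 : Fin p)),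
      Algebra.smul_def (c 0)]
    simp
  obtain ⟨i, hi, hi0, hwi⟩ := w.exists_map_sum_eq_of_distinct
    (fun i : Fin p => c i • t ^ (i : ℕ)) (Finset.univ.erase 0) (fun i _ j _ => hdist c i j) (by
      by_contra! h
      refine hyE ⟨0, ?_⟩
      rw [map_zero, ← hysum]
      exact (Finset.sum_eq_zero h).symm)
  obtain ⟨m, hm⟩ := hterm (c i) (fun h => hi0 (by rw [h, zero_smul])) i
  rw [hysum, hm] at hwi
  set n : ℤ := p * m + i
  have hpn : ¬ (p : ℤ) ∣ n := by
    intro h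
    have h1 : (p : ℤ) ∣ ((i : ℕ) : ℤ) := (Int.dvd_add_right (Dvd.intro m rfl)).1 h
    have h2 := Nat.eq_zero_of_dvd_of_lt (Int.natCast_dvd_natCast.1 h1) i.2
    exact (Finset.mem_erase.1 hi).1 (Fin.ext h2)
  have hya : y ^ p - y = algebraMap E F (a - (c 0 ^ p - c 0)) := by
    rw [hy, sub_pow_char, map_sub, map_sub, map_pow, ← hxa]
    ring
  set a' := a - (c 0 ^ p - c 0)
  have hypow : w (y ^ p) = ((p * n : ℤ) : WithTop ℤ) := by
    rw [w.map_pow, hwi, ← WithTop.coe_nsmul]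
    simp
  have hva (k : ℤ) (h : w (y ^ p - y) = (k : WithTop ℤ)) : ∃ r : ℤ, v a' = r ∧ k = p * r := by
    rw [hya, hw] at h
    have ha' : a' ≠ 0 := fun h0 => by
      rw [h0, ← hw, map_zero, w.map_zero] at h
      exact WithTop.top_ne_coe h
    obtain ⟨r, hr⟩ := v.exists_eq_coe ha'
    rw [hr, ← WithTop.coe_nsmul] at h
    refine ⟨r, hr, ?_⟩
    have := WithTop.coe_injective h
    simpa using this.symm
  have hp1 : (1 : ℤ) < p := mod_cast hp.1.one_lt
  have hn : n < 0 := by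
    by_contra! h0
    have hn0 : 0 < n := lt_of_le_of_ne h0 fun h => hpn (h ▸ dvd_zero _)
    obtain ⟨r, -, hr⟩ := hva n (by
      rw [w.map_sub_eq_of_lt_right, hwi]
      rw [hwi, hypow, WithTop.coe_lt_coe]
      nlinarith)
    exact hpn ⟨r, hr⟩
  obtain ⟨r, hvr, hr⟩ := hva (p * n) (by
    rw [w.map_sub_eq_of_lt_left, hypow]
    rw [hwi, hypow, WithTop.coe_lt_coe]
    nlinarith)
  have hr := mul_left_cancel₀ hpZ.ne' hr
  subst hr
  refine ⟨a', y, ?_, hya, ?_, n, hvr, hpn⟩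
  · have := IntermediateField.isSimpleOrder_of_finrank_prime E F (hdeg.symm ▸ hp.1)
    refine (eq_bot_or_eq_top _).resolve_left fun h => hyE ?_
    exact IntermediateField.mem_bot.1 (IntermediateField.adjoin_simple_eq_bot_iff.1 h)
  · rw [hvr]
    exact_mod_cast hn

/-- If `F = E(x)` with `x ^ p - x = a` of negative value prime to `p`, then the valuation is
totally ramified in `F`. -/
theorem TotallyRamifiedIn.of_generator {E F : Type} [Field E] [Field F] [Algebra E F]
    {p : ℕ} [hp : Fact p.Prime] (hdeg : Module.finrank E F = p)
    {v : AddValuation E (WithTop ℤ)} (hnorm : ∃ π : E, v π = (1 : ℤ)) {a : E} {x : F}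
    (hx : IntermediateField.adjoin E {x} = ⊤) (hxa : x ^ p - x = algebraMap E F a)
    {n : ℤ} (hvn : v a = (n : WithTop ℤ)) (hn : n < 0) (hpn : ¬ (p : ℤ) ∣ n) :
    TotallyRamifiedIn (F := F) v p := by
  have : FiniteDimensional E F := Module.finite_of_finrank_pos (hdeg ▸ hp.1.pos)
  have : NeZero p := ⟨hp.1.ne_zero⟩
  have hp1 := hp.1.one_lt
  have hli : LinearIndependent E fun i : Fin p => x ^ (i : ℕ) := by
    have h := linearIndependent_pow (K := E) x
    rwa [(Field.primitive_element_iff_minpoly_natDegree_eq E x).1 hx, hdeg] at h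
  let b := basisOfLinearIndependentOfCardEqFinrank hli (by simp [hdeg])
  have hb (i : Fin p) : b i = x ^ (i : ℕ) := by simp [b]
  let T (c : E) (k : ℕ) : WithTop ℤ := p • v c + ((k * n : ℤ) : WithTop ℤ)
  have hT0 (k : ℕ) : T 0 k = ⊤ := by
    obtain ⟨q, hq⟩ := Nat.exists_eq_succ_of_ne_zero hp.1.ne_zero
    simp only [T, v.map_zero]
    rw [hq, succ_nsmul, WithTop.add_top, WithTop.top_add]
  have hTv {c : E} {m : ℤ} (hm : v c = m) (k : ℕ) : T c k = ((p * m + k * n : ℤ) : WithTop ℤ) := by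
    simp only [T]
    rw [hm, ← WithTop.coe_nsmul, ← WithTop.coe_add, nsmul_eq_mul]
  have hTmul (c d : E) (i j : ℕ) : T (c * d) (i + j) = T c i + T d j := by
    simp only [T, v.map_mul, nsmul_add]
    rw [add_add_add_comm, ← WithTop.coe_add, Nat.cast_add, add_mul]
  have hTne {c d : E} (hc : c ≠ 0) {i j : Fin p} (hij : i ≠ j) : T c i ≠ T d j := by
    obtain ⟨m, hm⟩ := v.exists_eq_coe hc
    rw [hTv hm]
    by_cases hd : d = 0
    · rw [hd, hT0]
      exact WithTop.coe_ne_top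
    obtain ⟨m', hm'⟩ := v.exists_eq_coe hd
    rw [hTv hm']
    intro h
    have h := WithTop.coe_injective h
    have h1 : (p : ℤ) ∣ (((i : ℕ) : ℤ) - ((j : ℕ) : ℤ)) * n := ⟨m' - m, by linear_combination h⟩
    have h2 := ((Nat.prime_iff_prime_int.1 hp.1).dvd_or_dvd h1).resolve_right hpn
    have h3 := Int.eq_zero_of_abs_lt_dvd h2 (by
      have := i.2
      have := j.2
      rw [abs_lt]
      omega)
    exact hij (Fin.ext (by omega))
  let f (y : F) : WithTop ℤ := Finset.univ.inf fun i : Fin p => T (b.repr y i) i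
  have hle {y : F} {g : WithTop ℤ} : g ≤ f y ↔ ∀ i : Fin p, g ≤ T (b.repr y i) i := by
    simp [f, Finset.le_inf_iff]
  have hf0 : f 0 = ⊤ := top_le_iff.1 (hle.2 fun i => by simp [hT0])
  have hTadd (c d : E) (k : ℕ) : min (T c k) (T d k) ≤ T (c + d) k := by
    have h : min (v c) (v d) ≤ v (c + d) := v.map_add c d
    rcases min_le_iff.1 h with h | h
    · exact (min_le_left _ _).trans (add_le_add_left (nsmul_le_nsmul_right h p) _)
    · exact (min_le_right _ _).trans (add_le_add_left (nsmul_le_nsmul_right h p) _)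
  have hfadd (y z : F) : min (f y) (f z) ≤ f (y + z) := by
    refine hle.2 fun i => ?_
    rw [map_add, Finsupp.add_apply]
    exact (min_le_min (hle.1 le_rfl i) (hle.1 le_rfl i)).trans (hTadd _ _ _)
  have hfneg (y : F) : f (-y) = f y := by
    simp [f, T]
  have hflt {y z : F} (h : f y < f z) : f (y + z) = f y := by
    refine le_antisymm ?_ ((le_min le_rfl h.le).trans (hfadd y z))
    by_contra! h'
    have := hfadd (y + z) (-z)
    rw [add_neg_cancel_right, hfneg] at this
    exact absurd (lt_min h' h) (not_lt.2 this)
  have hfsum {ι : Type} (s : Finset ι) (u : ι → F) (g : WithTop ℤ) (h : ∀ i ∈ s, g ≤ f (u i)) :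
      g ≤ f (∑ i ∈ s, u i) := by
    classical
    induction s using Finset.induction_on with
    | empty => simp [hf0]
    | insert k s hk ih =>
      rw [Finset.sum_insert hk]
      exact (le_min (h k (Finset.mem_insert_self k s))
        (ih fun i hi => h i (Finset.mem_insert_of_mem hi))).trans (hfadd _ _)
  have hmono (c : E) (k : ℕ) : f (c • x ^ k) = T c k := by
    by_cases hc : c = 0
    · rw [hc, zero_smul, hf0, hT0]
    induction k using Nat.strong_induction_on generalizing c with
    | _ k ih =>
      rcases lt_or_ge k p with hk | hk
      · have hrepr : b.repr (c • x ^ k) = Finsupp.single ⟨k, hk⟩ c := by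
          rw [← hb ⟨k, hk⟩, map_smul, b.repr_self, Finsupp.smul_single, smul_eq_mul, mul_one]
        refine le_antisymm ?_ (hle.2 fun i => ?_)
        · have := hle.1 (le_refl (f (c • x ^ k))) ⟨k, hk⟩
          rwa [hrepr, Finsupp.single_eq_same] at this
        · rw [hrepr]
          by_cases hi : i = ⟨k, hk⟩
          · rw [hi, Finsupp.single_eq_same]
          · rw [Finsupp.single_eq_of_ne hi, hT0]
            exact le_top
      · obtain ⟨l, rfl⟩ := Nat.exists_eq_add_of_le hk
        have ha : a ≠ 0 := fun h => by
          rw [h, v.map_zero] at hvn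
          exact WithTop.top_ne_coe hvn
        have hsplit : c • x ^ (p + l) = (c * a) • x ^ l + c • x ^ (l + 1) := by
          rw [pow_add, eq_add_of_sub_eq hxa]
          simp only [Algebra.smul_def, map_mul]
          ring
        obtain ⟨m, hm⟩ := v.exists_eq_coe hc
        have h1 : f ((c * a) • x ^ l) = ((p * (m + n) + l * n : ℤ) : WithTop ℤ) := by
          rw [ih l (by omega) _ (mul_ne_zero hc ha)]
          exact hTv (by rw [v.map_mul, hm, hvn, WithTop.coe_add]) l
        have h2 : f (c • x ^ (l + 1)) = ((p * m + (l + 1 : ℕ) * n : ℤ) : WithTop ℤ) := by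
          rw [ih (l + 1) (by omega) _ hc, hTv hm]
        have hpZ : (1 : ℤ) < p := mod_cast hp1
        rw [hsplit, hflt, h1, hTv hm]
        · congr 1
          push_cast
          ring
        · rw [h1, h2, WithTop.coe_lt_coe]
          push_cast
          nlinarith
  have hlemul (y z : F) : f y + f z ≤ f (y * z) := by
    rw [← b.sum_repr y, ← b.sum_repr z, Finset.sum_mul_sum, b.sum_repr y, b.sum_repr z]
    refine hfsum _ _ _ fun i _ => hfsum _ _ _ fun j _ => ?_
    rw [smul_mul_smul_comm, hb, hb, ← pow_add, hmono, hTmul]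
    exact add_le_add (hle.1 le_rfl i) (hle.1 le_rfl j)
  have hlead (y : F) (hy : y ≠ 0) : ∃ (c : E) (k : ℕ) (y' : F), c ≠ 0 ∧ y = c • x ^ k + y' ∧
      f (c • x ^ k) < f y' := by
    obtain ⟨i, -, hi⟩ := Finset.exists_mem_eq_inf (Finset.univ : Finset (Fin p))
      Finset.univ_nonempty fun i : Fin p => T (b.repr y i) i
    have hmin (j : Fin p) : T (b.repr y i) i ≤ T (b.repr y j) j := hle.1 hi.ge j
    have hc : b.repr y i ≠ 0 := by
      intro h
      refine hy (b.repr.map_eq_zero_iff.1 (Finsupp.ext fun j => ?_))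
      by_contra hj
      have h1 := hmin j
      obtain ⟨m, hm⟩ := v.exists_eq_coe hj
      rw [h, hT0, hTv hm] at h1
      exact absurd h1 (not_le.2 (WithTop.coe_lt_top _))
    refine ⟨b.repr y i, i, y - b.repr y i • x ^ (i : ℕ), hc, by rw [add_sub_cancel], ?_⟩
    obtain ⟨m, hm⟩ := v.exists_eq_coe hc
    have htop : T (b.repr y i) i < ⊤ := by
      rw [hTv hm]
      exact WithTop.coe_lt_top _
    rw [hmono]
    refine (Finset.lt_inf_iff htop).2 fun j _ => ?_
    rw [← hb i, map_sub, map_smul, b.repr_self, Finsupp.smul_single, smul_eq_mul, mul_one,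
      Finsupp.sub_apply]
    by_cases hij : j = i
    · rw [hij, Finsupp.single_eq_same, sub_self, hT0]
      exact htop
    · rw [Finsupp.single_eq_of_ne hij, sub_zero]
      exact lt_of_le_of_ne (hmin j) (hTne hc (Ne.symm hij))
  have hfmul (y z : F) : f (y * z) = f y + f z := by
    by_cases hy : y = 0
    · rw [hy, zero_mul, hf0, WithTop.top_add]
    by_cases hz : z = 0
    · rw [hz, mul_zero, hf0, WithTop.add_top]
    obtain ⟨c, i, y', hc, rfl, hy'⟩ := hlead y hy
    obtain ⟨d, j, z', hd, rfl, hz'⟩ := hlead z hz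
    have hprod : f ((c • x ^ i) * (d • x ^ j)) = f (c • x ^ i) + f (d • x ^ j) := by
      rw [smul_mul_smul_comm, ← pow_add, hmono, hmono, hmono, hTmul]
    have hfin {c : E} (hc : c ≠ 0) (k : ℕ) : f (c • x ^ k) ≠ ⊤ := by
      obtain ⟨m, hm⟩ := v.exists_eq_coe hc
      rw [hmono, hTv hm]
      exact WithTop.coe_ne_top
    have hsplit : (c • x ^ i + y') * (d • x ^ j + z') =
        (c • x ^ i) * (d • x ^ j) + ((c • x ^ i) * z' + y' * (d • x ^ j + z')) := by ring
    rw [hsplit, hflt hy', hflt hz', hflt, hprod]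
    rw [hprod]
    refine (lt_min ?_ ?_).trans_le (hfadd _ _)
    · exact (WithTop.add_lt_add_left (hfin hc i) hz').trans_le (hlemul _ _)
    · refine lt_of_lt_of_le ?_ (hlemul _ _)
      rw [hflt hz']
      exact WithTop.add_lt_add_right (hfin hd j) hy'
  have hfE (c : E) : f (algebraMap E F c) = p • v c := by
    have := hmono c 0
    rw [pow_zero, ← Algebra.algebraMap_eq_smul_one] at this
    rw [this]
    simp [T]
  refine ⟨AddValuation.of f hf0 ?_ hfadd hfmul, ?_, hfE⟩
  · have := hfE 1
    rwa [map_one, v.map_one, smul_zero] at this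
  · have hcop : IsCoprime n (p : ℤ) :=
      ((Nat.prime_iff_prime_int.1 hp.1).coprime_iff_not_dvd.2 hpn).symm
    obtain ⟨r, s, hrs⟩ := hcop
    have hpZ : (0 : ℤ) < p := mod_cast hp.1.pos
    obtain ⟨k, hk⟩ := Int.eq_ofNat_of_zero_le (Int.emod_nonneg r hpZ.ne')
    obtain ⟨c, hc⟩ := v.exists_map_eq_of_normalized hnorm (s + r / p * n)
    refine ⟨c • x ^ k, ?_⟩
    rw [AddValuation.of_apply, hmono, hTv hc]
    congr 1
    have := Int.mul_ediv_add_emod r p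
    rw [hk] at this
    linear_combination hrs + n * this

/-- Let `E` be a field of characteristic `p > 0` with a normalized
discrete valuation `v`, and let `F/E` be a Galois extension of degree `p`.  Then `v` is
totally ramified in `F` if and only if there exist `a ∈ E` and `x ∈ F` with `F = E(x)`,
`x^p - x = a`, `v(a) < 0` and `p ∤ v(a)`. -/
theorem totallyRamified_iff_artinSchreier_generator
    (E F : Type) [Field E] [Field F] [Algebra E F] [IsGalois E F]
    (p : ℕ) [hp : Fact p.Prime] [CharP E p]
    (hdeg : Module.finrank E F = p)
    (v : AddValuation E (WithTop ℤ))
    (hnorm : ∃ π : E, v π = (1 : ℤ)) :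
    TotallyRamifiedIn (F := F) v p ↔
      ∃ (a : E) (x : F),
        IntermediateField.adjoin E {x} = ⊤ ∧
        x ^ p - x = algebraMap E F a ∧
        v a < 0 ∧
        ∃ n : ℤ, v a = (n : WithTop ℤ) ∧ ¬ ((p : ℤ) ∣ n) := by
  refine ⟨fun h => h.exists_generator hdeg, ?_⟩
  rintro ⟨a, x, hx, hxa, hneg, n, hvn, hpn⟩
  refine TotallyRamifiedIn.of_generator hdeg hnorm hx hxa hvn ?_ hpn
  rw [hvn] at hneg
  exact_mod_cast hneg
end
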